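/- arXiv:1703.09882 — 2 statements merged into one kernel-verified Lean document; each statement's English description precedes it below -/
import Mathlib

section
/- Let N ≥ 1 be an integer, let Ω be a bounded open subset of ℝ^N, let 1 < p < +∞, β > 0, and let r satisfy r ∈ [β+1, +∞) if p ≥ N and r ∈ [β+1, Np/(N−p)] if p < N. Set θ = (1/(β+1) − 1/r)/(1/N − 1/p + 1/(β+1)). Then there exists a constant C > 0 such that for every smooth function u : ℝ^N → ℝ with compact support contained in Ω, one has (∫_Ω |u|^r dx)^{1/r} ≤ C · (∫_Ω |∇u|^p dx)^{θ/p} · (∫_Ω |u|^{β+1} dx)^{(1−θ)/(β+1)}. -/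
open MeasureTheory Module
open scoped ENNReal NNReal

section NormPowers

theorem setIntegral_norm_rpow_of_tsupport_subset {E F : Type*} [TopologicalSpace E]
    [MeasurableSpace E] {μ : Measure E} [NormedAddCommGroup F] {f : E → F} {s : ℝ} {Ω : Set E} (hs : 0 < s)
    (hf : tsupport f ⊆ Ω) : ∫ x in Ω, ‖f x‖ ^ s ∂μ = ∫ x, ‖f x‖ ^ s ∂μ := by
  refine setIntegral_eq_integral_of_forall_compl_eq_zero fun x hx ↦ ?_
  rw [image_eq_zero_of_notMem_tsupport fun h ↦ hx (hf h), norm_zero, Real.zero_rpow hs.ne']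

variable {E F : Type*} [TopologicalSpace E] [MeasurableSpace E] [BorelSpace E]
  {μ : Measure E} [IsFiniteMeasureOnCompacts μ] [NormedAddCommGroup F]

theorem ofReal_integral_norm_rpow {f : E → F} (hf : Continuous f) (hc : HasCompactSupport f)
    {s : ℝ} (hs : 0 < s) :
    ENNReal.ofReal (∫ x, ‖f x‖ ^ s ∂μ) = ∫⁻ x, ‖f x‖ₑ ^ s ∂μ := by
  have hcont : Continuous fun x ↦ ‖f x‖ ^ s := hf.norm.rpow_const fun _ ↦ Or.inr hs.le
  have hint : Integrable (fun x ↦ ‖f x‖ ^ s) μ :=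
    hcont.integrable_of_hasCompactSupport (hc.norm.rpow_const hs.ne')
  rw [ofReal_integral_eq_lintegral_ofReal hint (.of_forall fun x ↦ by positivity)]
  refine lintegral_congr fun x ↦ ?_
  rw [← ENNReal.ofReal_rpow_of_nonneg (norm_nonneg _) hs.le, ofReal_norm]

theorem integral_norm_rpow_pos [μ.IsOpenPosMeasure] {f : E → F} (hf : Continuous f)
    (hc : HasCompactSupport f) (hne : f ≠ 0) {s : ℝ} (hs : 0 < s) :
    0 < ∫ x, ‖f x‖ ^ s ∂μ := by
  obtain ⟨x, hx⟩ := Function.ne_iff.mp hne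
  have hx : f x ≠ 0 := hx
  have hcont : Continuous fun x ↦ ‖f x‖ ^ s := hf.norm.rpow_const fun _ ↦ Or.inr hs.le
  exact hcont.integral_pos_of_hasCompactSupport_nonneg_nonzero (hc.norm.rpow_const hs.ne')
    (fun x ↦ by positivity) (x := x) (by positivity)

/-- Log-convexity of `s ↦ ∫ ‖f‖ ^ s`. -/
theorem log_integral_norm_rpow_le [μ.IsOpenPosMeasure] {f : E → F} (hf : Continuous f)
    (hc : HasCompactSupport f) (hne : f ≠ 0) {a b s : ℝ} (ha : 0 < a) (has : a ≤ s) (hsb : s ≤ b)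
    (hab : a < b) :
    (b - a) * Real.log (∫ x, ‖f x‖ ^ s ∂μ) ≤
      (b - s) * Real.log (∫ x, ‖f x‖ ^ a ∂μ) + (s - a) * Real.log (∫ x, ‖f x‖ ^ b ∂μ) := by
  have hs : 0 < s := ha.trans_le has
  have hb : 0 < b := ha.trans hab
  have hd : 0 < b - a := sub_pos.2 hab
  have hl : 0 ≤ (b - s) / (b - a) := div_nonneg (by linarith) hd.le
  have hm : 0 ≤ (s - a) / (b - a) := div_nonneg (by linarith) hd.le
  have hlm : (b - s) / (b - a) + (s - a) / (b - a) = 1 := by field_simp; ring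
  have key := ENNReal.lintegral_mul_norm_pow_le (μ := μ) (f := fun x ↦ ‖f x‖ₑ ^ a)
    (g := fun x ↦ ‖f x‖ₑ ^ b) (hf.enorm.measurable.pow_const a).aemeasurable
    (hf.enorm.measurable.pow_const b).aemeasurable hl hm hlm
  have heq : ∀ x, (‖f x‖ₑ ^ a) ^ ((b - s) / (b - a)) * (‖f x‖ₑ ^ b) ^ ((s - a) / (b - a)) =
      ‖f x‖ₑ ^ s := fun x ↦ by
    rw [← ENNReal.rpow_mul, ← ENNReal.rpow_mul, ← ENNReal.rpow_add_of_nonneg _ _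
      (by positivity) (by positivity)]
    congr 1
    field_simp
    ring
  simp_rw [heq] at key
  have Ia := integral_norm_rpow_pos (μ := μ) hf hc hne ha
  have Ib := integral_norm_rpow_pos (μ := μ) hf hc hne hb
  have Is := integral_norm_rpow_pos (μ := μ) hf hc hne hs
  rw [← ofReal_integral_norm_rpow hf hc ha, ← ofReal_integral_norm_rpow hf hc hb,
    ← ofReal_integral_norm_rpow hf hc hs, ENNReal.ofReal_rpow_of_nonneg Ia.le hl,
    ENNReal.ofReal_rpow_of_nonneg Ib.le hm, ← ENNReal.ofReal_mul (by positivity),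
    ENNReal.ofReal_le_ofReal_iff (by positivity)] at key
  have hlog := Real.log_le_log Is key
  rw [Real.log_mul (by positivity) (by positivity), Real.log_rpow Ia, Real.log_rpow Ib] at hlog
  refine (mul_le_mul_of_nonneg_left hlog hd.le).trans_eq ?_
  field_simp

end NormPowers

section Gradient

variable {E : Type*} [NormedAddCommGroup E] [NormedSpace ℝ E] [MeasurableSpace E] [BorelSpace E]
  {μ : Measure E}

theorem lintegral_enorm_fderiv_norm_rpow_le [IsFiniteMeasureOnCompacts μ] {u : E → ℝ} (hu : ContDiff ℝ 1 u)
    (hc : HasCompactSupport u) {γ p p' : ℝ} (hγ : 1 < γ) (hp : p.HolderConjugate p') :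
    ∫⁻ x, ‖fderiv ℝ (fun y ↦ ‖u y‖ ^ γ) x‖ₑ ∂μ ≤
      ENNReal.ofReal (γ * ((∫ x, ‖u x‖ ^ ((γ - 1) * p') ∂μ) ^ (1 / p') *
        (∫ x, ‖fderiv ℝ u x‖ ^ p ∂μ) ^ (1 / p))) := by
  have hp' := hp.symm.pos
  have hu0 := hu.continuous
  have hu1 : Continuous (fderiv ℝ u) := hu.continuous_fderiv one_ne_zero
  lift γ to ℝ≥0 using by linarith
  have hs : 0 < ((γ : ℝ) - 1) * p' := mul_pos (by linarith) hp'
  calc ∫⁻ x, ‖fderiv ℝ (fun y ↦ ‖u y‖ ^ (γ : ℝ)) x‖ₑ ∂μ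
      ≤ ∫⁻ x, γ * (‖u x‖ₑ ^ ((γ : ℝ) - 1) * ‖fderiv ℝ u x‖ₑ) ∂μ := by
        refine lintegral_mono fun x ↦ ?_
        rw [← mul_assoc]
        exact enorm_fderiv_norm_rpow_le (hu.differentiable one_ne_zero) (mod_cast hγ)
    _ = γ * ∫⁻ x, ‖u x‖ₑ ^ ((γ : ℝ) - 1) * ‖fderiv ℝ u x‖ₑ ∂μ := by
        rw [lintegral_const_mul]
        fun_prop
    _ ≤ γ * ((∫⁻ x, (‖u x‖ₑ ^ ((γ : ℝ) - 1)) ^ p' ∂μ) ^ (1 / p') *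
          (∫⁻ x, ‖fderiv ℝ u x‖ₑ ^ p ∂μ) ^ (1 / p)) := by
        gcongr
        exact ENNReal.lintegral_mul_le_Lp_mul_Lq μ hp.symm (by fun_prop) (by fun_prop)
    _ = _ := by
        simp_rw [← ENNReal.rpow_mul]
        rw [← ofReal_integral_norm_rpow hu0 hc hs,
          ← ofReal_integral_norm_rpow hu1 (hc.fderiv ℝ) hp.pos,
          ENNReal.ofReal_rpow_of_nonneg (by positivity) (by positivity),
          ENNReal.ofReal_rpow_of_nonneg (by positivity) (one_div_nonneg.2 hp.nonneg),
          ← ENNReal.ofReal_mul (by positivity), ENNReal.ofReal_mul (p := (γ : ℝ)) (by positivity),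
          ENNReal.ofReal_coe_nnreal]

theorem integral_norm_rpow_mul_le [FiniteDimensional ℝ E] [μ.IsAddHaarMeasure]
    {γ p p' n' : ℝ} (hγ : 1 < γ)
    (hp : p.HolderConjugate p') (hn : Real.HolderConjugate (finrank ℝ E) n') :
    ∃ C > 0, ∀ u : E → ℝ, ContDiff ℝ 1 u → HasCompactSupport u →
      ∫ x, ‖u x‖ ^ (γ * n') ∂μ ≤ C * ((∫ x, ‖u x‖ ^ ((γ - 1) * p') ∂μ) ^ (1 / p') *
        (∫ x, ‖fderiv ℝ u x‖ ^ p ∂μ) ^ (1 / p)) ^ n' := by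
  have hn' := hn.symm.pos
  have hγ0 : 0 < γ := by linarith
  set K := lintegralPowLePowLIntegralFDerivConst μ n'
  refine ⟨(K + 1) * γ ^ n', by positivity, fun u hu hc ↦ ?_⟩
  have h := lintegral_pow_le_pow_lintegral_fderiv μ (hu.norm_rpow hγ)
    (hc.norm.rpow_const hγ0.ne') hn
  have h2 := h.trans (mul_le_mul_right (ENNReal.rpow_le_rpow
    (lintegral_enorm_fderiv_norm_rpow_le (μ := μ) hu hc hγ hp) hn'.le) _)
  have heq : ∀ x, ‖‖u x‖ ^ γ‖ₑ ^ n' = ‖u x‖ₑ ^ (γ * n') := fun x ↦ by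
    rw [Real.enorm_rpow_of_nonneg (norm_nonneg _) hγ0.le, enorm_norm, ENNReal.rpow_mul]
  simp_rw [heq] at h2
  rw [← ofReal_integral_norm_rpow hu.continuous hc (by positivity),
    ENNReal.ofReal_rpow_of_nonneg (by positivity) hn'.le, ← ENNReal.ofReal_coe_nnreal,
    ← ENNReal.ofReal_mul (by positivity), ENNReal.ofReal_le_ofReal_iff (by positivity),
    Real.mul_rpow hγ0.le (by positivity)] at h2
  refine h2.trans ?_
  rw [← mul_assoc]
  gcongr
  simp [K]

theorem norm_rpow_le_integral_fderiv {u : EuclideanSpace ℝ (Fin 1) → ℝ} (hu : ContDiff ℝ 1 u)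
    (hc : HasCompactSupport u) {γ p p' : ℝ} (hγ : 1 < γ) (hp : p.HolderConjugate p')
    (x : EuclideanSpace ℝ (Fin 1)) :
    ‖u x‖ ^ γ ≤ γ * ((∫ x, ‖u x‖ ^ ((γ - 1) * p')) ^ (1 / p') *
        (∫ x, ‖fderiv ℝ u x‖ ^ p) ^ (1 / p)) := by
  have hγ0 : 0 < γ := by linarith
  let e : ℝ ≃ₗᵢ[ℝ] EuclideanSpace ℝ (Fin 1) := (OrthonormalBasis.singleton (Fin 1) ℝ).repr
  let v : EuclideanSpace ℝ (Fin 1) → ℝ := fun y ↦ ‖u y‖ ^ γ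
  have hv : ContDiff ℝ 1 v := hu.norm_rpow hγ
  have hvc : HasCompactSupport v := hc.norm.rpow_const hγ0.ne'
  have key := lintegral_enorm_fderiv_norm_rpow_le (μ := volume) hu hc hγ hp
  have h : ‖v x‖ₑ ≤ ∫⁻ y, ‖fderiv ℝ v y‖ₑ := by
    calc ‖v x‖ₑ = ‖(v ∘ e) (e.symm x)‖ₑ := by simp
      _ ≤ ∫⁻ t in Set.Iic (e.symm x), ‖deriv (v ∘ e) t‖ₑ :=
        HasCompactSupport.enorm_le_lintegral_Ici_deriv (hv.comp e.contDiff)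
          (hvc.comp_homeomorph e.toHomeomorph) _
      _ ≤ ∫⁻ t, ‖deriv (v ∘ e) t‖ₑ := setLIntegral_le_lintegral _ _
      _ ≤ ∫⁻ t, ‖fderiv ℝ v (e t)‖ₑ := by
        refine lintegral_mono fun t ↦ ?_
        have hd : HasDerivAt (v ∘ e) (fderiv ℝ v (e t) (e 1)) t := by
          have h1 : HasDerivAt e (e 1) t := e.toContinuousLinearEquiv.toContinuousLinearMap.hasDerivAt
          exact ((hv.differentiable one_ne_zero (e t)).hasFDerivAt).comp_hasDerivAt t h1
        rw [hd.deriv]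
        refine (ContinuousLinearMap.le_opENorm _ _).trans_eq ?_
        rw [← ofReal_norm (e 1)]
        simp
      _ = ∫⁻ y, ‖fderiv ℝ v y‖ₑ := by
        have := hv.continuous_fderiv one_ne_zero
        exact e.measurePreserving.lintegral_comp (f := fun y ↦ ‖fderiv ℝ v y‖ₑ) (by fun_prop)
  have h2 := h.trans key
  rw [← ofReal_norm, ENNReal.ofReal_le_ofReal_iff (by positivity)] at h2
  simpa [v, abs_of_nonneg, Real.rpow_nonneg] using h2

theorem integral_norm_rpow_sobolev_le [FiniteDimensional ℝ E] [μ.IsAddHaarMeasure]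
    {p q : ℝ} (hp : 1 ≤ p) (hq : 0 < q) (hE : 0 < finrank ℝ E)
    (hpq : q⁻¹ = p⁻¹ - (finrank ℝ E : ℝ)⁻¹) :
    ∃ C > 0, ∀ u : E → ℝ, ContDiff ℝ 1 u → HasCompactSupport u →
      (∫ x, ‖u x‖ ^ q ∂μ) ^ (1 / q) ≤ C * (∫ x, ‖fderiv ℝ u x‖ ^ p ∂μ) ^ (1 / p) := by
  lift p to ℝ≥0 using by linarith
  lift q to ℝ≥0 using hq.le
  set K := eLpNormLESNormFDerivOfEqInnerConst μ p
  have hp0 : (0 : ℝ) < p := by linarith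
  refine ⟨K + 1, by positivity, fun u hu hc ↦ ?_⟩
  have h := eLpNorm_le_eLpNorm_fderiv_of_eq_inner μ hu hc (mod_cast hp) hE hpq
  rw [eLpNorm_nnreal_eq_lintegral (mod_cast hq.ne'), eLpNorm_nnreal_eq_lintegral (mod_cast hp0.ne'),
    ← ofReal_integral_norm_rpow hu.continuous hc hq,
    ← ofReal_integral_norm_rpow (hu.continuous_fderiv one_ne_zero) (hc.fderiv ℝ) hp0,
    ENNReal.ofReal_rpow_of_nonneg (by positivity) (by positivity),
    ENNReal.ofReal_rpow_of_nonneg (by positivity) (by positivity), ← ENNReal.ofReal_coe_nnreal,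
    ← ENNReal.ofReal_mul (by positivity), ENNReal.ofReal_le_ofReal_iff (by positivity)] at h
  refine h.trans ?_
  gcongr
  simp [K]

end Gradient

section GagliardoNirenberg

/-- The exponent of the gradient in the Gagliardo-Nirenberg inequality bounding the `L^r` norm by
the `L^p` norm of the gradient and the `L^q` norm in dimension `n`. -/
noncomputable def gnExponent (n p q r : ℝ) : ℝ :=
  (1 / q - 1 / r) / (1 / n - 1 / p + 1 / q)

/-- The Gagliardo-Nirenberg inequality for nonzero functions, in logarithmic form. -/
def LogGagliardoNirenberg (N : ℕ) (p q r : ℝ) : Prop :=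
  ∃ c : ℝ, 0 ≤ c ∧ ∀ u : EuclideanSpace ℝ (Fin N) → ℝ, ContDiff ℝ 1 u → HasCompactSupport u →
    u ≠ 0 → 0 < ∫ x, ‖fderiv ℝ u x‖ ^ p ∧
      Real.log (∫ x, ‖u x‖ ^ r) / r ≤
        c + gnExponent N p q r / p * Real.log (∫ x, ‖fderiv ℝ u x‖ ^ p) +
          (1 - gnExponent N p q r) / q * Real.log (∫ x, ‖u x‖ ^ q)

theorem LogGagliardoNirenberg.of_le {N : ℕ} {p q r R : ℝ} (h : LogGagliardoNirenberg N p q R)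
    (hq : 0 < q) (hqr : q ≤ r) (hrR : r ≤ R) (hqR : q < R) : LogGagliardoNirenberg N p q r := by
  obtain ⟨c, hc, h⟩ := h
  refine ⟨c, hc, fun u hu huc hne ↦ ⟨(h u hu huc hne).1, ?_⟩⟩
  have h1 := (h u hu huc hne).2
  have h2 := log_integral_norm_rpow_le (μ := volume) hu.continuous huc hne hq hqr hrR hqR
  have hr : 0 < r := by linarith
  have hR : 0 < R := by linarith
  have hd : 0 < R - q := by linarith
  generalize Real.log (∫ x, ‖u x‖ ^ r) = Lr at *
  generalize Real.log (∫ x, ‖u x‖ ^ q) = Lq at *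
  generalize Real.log (∫ x, ‖u x‖ ^ R) = LR at *
  generalize Real.log (∫ x, ‖fderiv ℝ u x‖ ^ p) = J at *
  have hθ : gnExponent N p q r = R * (r - q) / (r * (R - q)) * gnExponent N p q R := by
    simp only [gnExponent]
    rw [← mul_div_assoc]
    congr 1
    field_simp
  rw [hθ]
  generalize gnExponent N p q R = T at *
  have hδ0 : 0 ≤ R * (r - q) / (r * (R - q)) :=
    div_nonneg (mul_nonneg hR.le (by linarith)) (by positivity)
  have hδ1 : R * (r - q) / (r * (R - q)) ≤ 1 := by
    rw [div_le_one (by positivity)]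
    nlinarith
  have h3 : Lr / r ≤ (1 - R * (r - q) / (r * (R - q))) * (Lq / q) +
      R * (r - q) / (r * (R - q)) * (LR / R) := by
    have : (1 - R * (r - q) / (r * (R - q))) * (Lq / q) + R * (r - q) / (r * (R - q)) * (LR / R) =
        ((R - r) * Lq + (r - q) * LR) / (R - q) / r := by
      field_simp
      ring
    rw [this]
    gcongr
    rw [le_div_iff₀ hd]
    linarith
  generalize R * (r - q) / (r * (R - q)) = δ at *
  have h4 := mul_le_mul_of_nonneg_left h1 hδ0
  have h5 := mul_le_mul_of_nonneg_right hδ1 hc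
  have h6 : (1 - δ) * (Lq / q) + δ * (c + T / p * J + (1 - T) / q * Lq) =
      δ * c + δ * T / p * J + (1 - δ * T) / q * Lq := by
    field_simp
    ring
  linarith

theorem logGagliardoNirenberg_sobolev {N : ℕ} {p q : ℝ} (hp : 1 ≤ p) (hpN : p < N) (hq : 0 < q)
    (hqp : q < N * p / (N - p)) : LogGagliardoNirenberg N p q (N * p / (N - p)) := by
  have hN : (0 : ℝ) < N := by linarith
  have hp0 : 0 < p := by linarith
  have hd : 0 < N - p := by linarith
  have hR : 0 < N * p / (N - p) := by positivity
  obtain ⟨C, hC, h⟩ := integral_norm_rpow_sobolev_le (E := EuclideanSpace ℝ (Fin N))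
    (μ := volume) (p := p) (q := N * p / (N - p)) hp hR (by simpa using hN)
    (by rw [finrank_euclideanSpace_fin]; field_simp)
  refine ⟨|Real.log C|, abs_nonneg _, fun u hu huc hne ↦ ?_⟩
  have h1 := h u hu huc
  have hT : gnExponent N p q (N * p / (N - p)) = 1 := by
    have e : (1 : ℝ) / q - 1 / (N * p / (N - p)) = 1 / N - 1 / p + 1 / q := by
      field_simp
      ring
    rw [gnExponent, ← e]
    refine div_self (sub_pos.2 ?_).ne'
    exact one_div_lt_one_div_of_lt hq hqp
  rw [hT]
  generalize N * p / (N - p) = R at *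
  have hI := integral_norm_rpow_pos (μ := volume) hu.continuous huc hne hR
  have hJ : 0 < ∫ x, ‖fderiv ℝ u x‖ ^ p := by
    refine lt_of_le_of_ne (by positivity) fun h0 ↦ ?_
    rw [← h0, Real.zero_rpow (by positivity), mul_zero] at h1
    exact absurd h1 (not_le.2 (by positivity))
  refine ⟨hJ, ?_⟩
  have h2 := Real.log_le_log (by positivity) h1
  rw [Real.log_mul hC.ne' (by positivity), Real.log_rpow hI, Real.log_rpow hJ] at h2
  have h3 := le_abs_self (Real.log C)
  rw [one_div_mul_eq_div] at h2
  simp only [sub_self, zero_div, zero_mul, add_zero]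
  linarith

theorem logGagliardoNirenberg_one {p q r : ℝ} (hp : 1 < p) (hq : 0 < q) (hqr : q < r) :
    LogGagliardoNirenberg 1 p q r := by
  have hr : 0 < r := hq.trans hqr
  have hpc := Real.HolderConjugate.conjExponent hp
  set p' := Real.conjExponent p
  have hp0 := hpc.pos
  have hp'0 := hpc.symm.pos
  have hγ : 1 < 1 + q / p' := lt_add_of_pos_right _ (by positivity)
  have hγq : (1 + q / p' - 1) * p' = q := by field_simp; ring
  have hT : gnExponent (1 : ℕ) p q r = (r - q) / (r * (1 + q / p')) := by
    have e : (1 : ℝ) / (1 : ℕ) - 1 / p + 1 / q = (1 + q / p') / q := by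
      have := hpc.inv_add_inv_eq_one
      rw [add_div, div_right_comm, div_self hq.ne', one_div p', one_div p, Nat.cast_one]
      linarith
    rw [gnExponent, e]
    have : 0 < 1 + q / p' := by linarith
    field_simp
  rw [LogGagliardoNirenberg, hT]
  have key := fun u hu huc x ↦ norm_rpow_le_integral_fderiv (u := u) hu huc hγ hpc x
  rw [hγq] at key
  have hinv : 1 / p' = 1 - 1 / p := by
    have := hpc.inv_add_inv_eq_one
    simp only [one_div]
    linarith
  have hγ' : 1 + q / p' = 1 + q * (1 - 1 / p) := by rw [← hinv]; ring
  generalize 1 + q / p' = γ at *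
  have hγ0 : 0 < γ := by linarith
  have hlγ : 0 < Real.log γ := Real.log_pos hγ
  have he : 0 < (r - q) / γ := div_pos (by linarith) hγ0
  refine ⟨(r - q) / (r * γ) * Real.log γ,
    mul_nonneg (div_nonneg (by linarith) (by positivity)) hlγ.le, fun u hu huc hne ↦ ?_⟩
  have hI := integral_norm_rpow_pos (μ := volume) hu.continuous huc hne hr
  have hIq := integral_norm_rpow_pos (μ := volume) hu.continuous huc hne hq
  have hint : ∀ {s : ℝ}, 0 < s → Integrable fun x ↦ ‖u x‖ ^ s := fun hs ↦
    (hu.continuous.norm.rpow_const fun _ ↦ Or.inr hs.le).integrable_of_hasCompactSupport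
      (huc.norm.rpow_const hs.ne')
  have key := key u hu huc
  set X := γ * ((∫ x, ‖u x‖ ^ q) ^ (1 / p') * (∫ x, ‖fderiv ℝ u x‖ ^ p) ^ (1 / p)) with hX
  have h1 : ∫ x, ‖u x‖ ^ r ≤ X ^ ((r - q) / γ) * ∫ x, ‖u x‖ ^ q := by
    rw [← integral_const_mul]
    refine integral_mono (hint hr) ((hint hq).const_mul _) fun x ↦ ?_
    calc ‖u x‖ ^ r = (‖u x‖ ^ γ) ^ ((r - q) / γ) * ‖u x‖ ^ q := by
          rw [← Real.rpow_mul (norm_nonneg _), ← Real.rpow_add_of_nonneg (norm_nonneg _)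
            (by positivity) hq.le]
          congr 1
          field_simp
          ring
      _ ≤ X ^ ((r - q) / γ) * ‖u x‖ ^ q := by
          gcongr
          exact key x
  have hJ : 0 < ∫ x, ‖fderiv ℝ u x‖ ^ p := by
    refine lt_of_le_of_ne (by positivity) fun h0 ↦ ?_
    rw [← h0, Real.zero_rpow (by positivity), mul_zero, mul_zero] at hX
    rw [hX, Real.zero_rpow he.ne', zero_mul] at h1
    exact absurd h1 (not_le.2 hI)
  refine ⟨hJ, ?_⟩
  have h2 := Real.log_le_log hI h1
  rw [Real.log_mul (by positivity) hIq.ne', Real.log_rpow (by positivity), hX,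
    Real.log_mul hγ0.ne' (by positivity), Real.log_mul (by positivity) (by positivity),
    Real.log_rpow hIq, Real.log_rpow hJ, hinv] at h2
  refine (div_le_div_of_nonneg_right h2 hr.le).trans_eq ?_
  field_simp
  rw [hγ']
  field_simp
  ring

theorem logGagliardoNirenberg_of_dim_le {N : ℕ} {p q γ : ℝ} (hN : 2 ≤ N) (hpN : N ≤ p) (hq : 0 < q)
    (hγ : 1 + q * (1 - 1 / p) ≤ γ) : LogGagliardoNirenberg N p q (γ / (1 - 1 / N)) := by
  have hN2 : (2 : ℝ) ≤ N := by exact_mod_cast hN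
  have hN1 : (1 : ℝ) < N := by linarith
  have hp : 1 < p := by linarith
  have hpc := Real.HolderConjugate.conjExponent hp
  have hnc := Real.HolderConjugate.conjExponent hN1
  set p' := Real.conjExponent p
  set n' := Real.conjExponent (N : ℝ)
  have hp0 := hpc.pos
  have hp'0 := hpc.symm.pos
  have hn'0 := hnc.symm.pos
  have hpi : 1 / p' = 1 - 1 / p := by
    have := hpc.inv_add_inv_eq_one
    simp only [one_div]
    linarith
  have hni : 1 / n' = 1 - 1 / N := by
    have := hnc.inv_add_inv_eq_one
    simp only [one_div]
    linarith
  have hpn : p' ≤ n' := by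
    rw [← one_div_le_one_div hn'0 hp'0, hpi, hni]
    gcongr
  have hR : γ / (1 - 1 / N) = γ * n' := by rw [← hni]; field_simp
  have hγq : 1 + q / p' ≤ γ := by rw [div_eq_mul_one_div, hpi]; exact hγ
  have hγ1 : 1 < γ := lt_of_lt_of_le (lt_add_of_pos_right _ (by positivity)) hγq
  have hγ0 : 0 < γ := by linarith
  rw [hR]
  have hs : q ≤ (γ - 1) * p' := by
    rw [← div_le_iff₀ hp'0]
    linarith
  have hsR : (γ - 1) * p' < γ * n' := by nlinarith
  have hqR : q < γ * n' := by linarith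
  have hden : 0 < n' * p' + (n' - p') * q := by
    have : 0 ≤ (n' - p') * q := mul_nonneg (by linarith) hq.le
    positivity
  have hT : gnExponent N p q (γ * n') =
      (γ * n' - q) * p' / (γ * (n' * p' + (n' - p') * q)) := by
    have e : (1 : ℝ) / N - 1 / p + 1 / q = (n' * p' + (n' - p') * q) / (n' * p' * q) := by
      have : (1 : ℝ) / N - 1 / p = 1 / p' - 1 / n' := by rw [hpi, hni]; ring
      rw [this]
      field_simp
      ring
    rw [gnExponent, e]
    field_simp
  rw [LogGagliardoNirenberg, hT]
  obtain ⟨C, hC, h⟩ := integral_norm_rpow_mul_le (E := EuclideanSpace ℝ (Fin N)) (μ := volume)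
    hγ1 hpc (n' := n') (by rwa [finrank_euclideanSpace_fin])
  have hd : 0 < γ * n' - q := by linarith
  refine ⟨|Real.log C| * (p' * (γ * n' - q)) / (n' * p' + (n' - p') * q) / (γ * n'),
    by positivity, fun u hu huc hne ↦ ?_⟩
  have hI := integral_norm_rpow_pos (μ := volume) hu.continuous huc hne (hq.trans hqR)
  have hIs := integral_norm_rpow_pos (μ := volume) hu.continuous huc hne (hq.trans_le hs)
  have h1 := h u hu huc
  have hJ : 0 < ∫ x, ‖fderiv ℝ u x‖ ^ p := by
    refine lt_of_le_of_ne (by positivity) fun h0 ↦ ?_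
    rw [← h0, Real.zero_rpow (one_div_pos.2 hp0).ne', mul_zero, Real.zero_rpow hn'0.ne',
      mul_zero] at h1
    exact absurd h1 (not_le.2 hI)
  refine ⟨hJ, ?_⟩
  have h2 := Real.log_le_log hI h1
  rw [Real.log_mul hC.ne' (by positivity), Real.log_rpow (by positivity),
    Real.log_mul (by positivity) (by positivity), Real.log_rpow hIs, Real.log_rpow hJ] at h2
  have h3 := log_integral_norm_rpow_le (μ := volume) hu.continuous huc hne hq hs hsR.le hqR
  have h4 := le_abs_self (Real.log C)
  generalize Real.log (∫ x, ‖u x‖ ^ (γ * n')) = LR at *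
  generalize Real.log (∫ x, ‖u x‖ ^ ((γ - 1) * p')) = Ls at *
  generalize Real.log (∫ x, ‖u x‖ ^ q) = Lq at *
  generalize Real.log (∫ x, ‖fderiv ℝ u x‖ ^ p) = J at *
  generalize |Real.log C| = c at *
  generalize Real.log C = c₀ at *
  have h5 : LR * (n' * p' + (n' - p') * q) ≤ c * (p' * (γ * n' - q)) +
      n' * (γ * n' - (γ - 1) * p') * Lq + n' * p' * (γ * n' - q) / p * J := by
    have h6 : LR ≤ c + n' * (1 / p' * Ls + 1 / p * J) := by linarith
    have h7 := mul_le_mul_of_nonneg_right h6 (mul_pos hp'0 hd).le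
    have h8 : (c + n' * (1 / p' * Ls + 1 / p * J)) * (p' * (γ * n' - q)) =
        c * (p' * (γ * n' - q)) + n' * ((γ * n' - q) * Ls) + n' * p' * (γ * n' - q) / p * J := by
      field_simp
      ring
    have h9 := mul_le_mul_of_nonneg_left h3 hn'0.le
    nlinarith
  rw [← le_div_iff₀ hden] at h5
  refine (div_le_div_of_nonneg_right h5 (by positivity : 0 ≤ γ * n')).trans_eq ?_
  generalize hD : n' * p' + (n' - p') * q = D at *
  generalize hd' : γ * n' - q = d at *
  have hcoef : 1 - d * p' / (γ * D) = q * (γ * n' - (γ - 1) * p') / (γ * D) := by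
    field_simp
    rw [← hD, ← hd']
    ring
  rw [hcoef]
  field_simp
  ring

theorem logGagliardoNirenberg {N : ℕ} {p q r : ℝ} (hN : 1 ≤ N) (hp : 1 < p) (hq : 0 < q)
    (hqr : q < r) (hr : p < N → r ≤ N * p / (N - p)) : LogGagliardoNirenberg N p q r := by
  rcases lt_or_ge p (N : ℝ) with hpN | hpN
  · have hqR := hqr.trans_le (hr hpN)
    exact (logGagliardoNirenberg_sobolev hp.le hpN hq hqR).of_le hq hqr.le (hr hpN) hqR
  rcases hN.eq_or_lt with rfl | hN
  · exact logGagliardoNirenberg_one hp hq hqr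
  have hN2 : (1 : ℝ) < N := by exact_mod_cast hN
  have hd : 0 < 1 - 1 / (N : ℝ) := sub_pos.2 (by rw [div_lt_one] <;> linarith)
  have hrR : r ≤ max (1 + q * (1 - 1 / p)) (r * (1 - 1 / N)) / (1 - 1 / N) := by
    rw [le_div_iff₀ hd]
    exact le_max_right _ _
  exact (logGagliardoNirenberg_of_dim_le hN hpN hq (le_max_left _ _)).of_le hq hqr.le hrR
    (hqr.trans_le hrR)

theorem LogGagliardoNirenberg.integral_le {N : ℕ} {p q r : ℝ} (h : LogGagliardoNirenberg N p q r)
    (hq : 0 < q) (hr : 0 < r) :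
    ∃ C > 0, ∀ u : EuclideanSpace ℝ (Fin N) → ℝ, ContDiff ℝ 1 u → HasCompactSupport u →
      (∫ x, ‖u x‖ ^ r) ^ (1 / r) ≤
        C * (∫ x, ‖fderiv ℝ u x‖ ^ p) ^ (gnExponent N p q r / p) *
          (∫ x, ‖u x‖ ^ q) ^ ((1 - gnExponent N p q r) / q) := by
  obtain ⟨c, -, h⟩ := h
  refine ⟨Real.exp c, Real.exp_pos c, fun u hu huc ↦ ?_⟩
  rcases eq_or_ne u 0 with rfl | hne
  · simp only [Pi.zero_apply, norm_zero, Real.zero_rpow hr.ne', integral_zero,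
      Real.zero_rpow (one_div_pos.2 hr).ne']
    positivity
  obtain ⟨hJ, hle⟩ := h u hu huc hne
  have hI := integral_norm_rpow_pos (μ := volume) hu.continuous huc hne hr
  have hIq := integral_norm_rpow_pos (μ := volume) hu.continuous huc hne hq
  rw [Real.rpow_def_of_pos hI, Real.rpow_def_of_pos hJ, Real.rpow_def_of_pos hIq, ← Real.exp_add,
    ← Real.exp_add, Real.exp_le_exp]
  linarith [mul_one_div (Real.log (∫ x, ‖u x‖ ^ r)) r]

end GagliardoNirenberg

/-- Gagliardo–Nirenberg type interpolation inequality (Lemma 4.1). -/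
theorem gagliardo_nirenberg_type
    (N : ℕ) (hN : 1 ≤ N) (Ω : Set (EuclideanSpace ℝ (Fin N)))
    (hΩo : IsOpen Ω) (hΩb : Bornology.IsBounded Ω)
    (p β r : ℝ) (hp1 : 1 < p) (hβ : 0 < β)
    (hr1 : β + 1 ≤ r) (hr2 : p < N → r ≤ N * p / (N - p))
    (θ : ℝ) (hθ : θ = (1 / (β + 1) - 1 / r) / (1 / N - 1 / p + 1 / (β + 1))) :
    ∃ C > (0 : ℝ), ∀ u : EuclideanSpace ℝ (Fin N) → ℝ,
      ContDiff ℝ (⊤ : ℕ∞) u → HasCompactSupport u → tsupport u ⊆ Ω →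
      (∫ x in Ω, |u x| ^ r) ^ (1 / r) ≤
        C * (∫ x in Ω, ‖fderiv ℝ u x‖ ^ p) ^ (θ / p) *
          (∫ x in Ω, |u x| ^ (β + 1)) ^ ((1 - θ) / (β + 1)) := by
  have hq : 0 < β + 1 := by linarith
  have hr : 0 < r := by linarith
  have hp : 0 < p := by linarith
  rcases hr1.eq_or_lt with hqr | hqr
  · refine ⟨1, one_pos, fun u _ _ _ ↦ ?_⟩
    have hθ0 : θ = 0 := by rw [hθ, hqr, sub_self, zero_div]
    simp [hθ0, hqr]
  obtain ⟨C, hC, h⟩ := (logGagliardoNirenberg hN hp1 hq hqr hr2).integral_le hq hr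
  refine ⟨C, hC, fun u hu huc hsupp ↦ ?_⟩
  have hθ' : θ = gnExponent N p (β + 1) r := hθ
  simp only [← Real.norm_eq_abs]
  rw [setIntegral_norm_rpow_of_tsupport_subset hr hsupp,
    setIntegral_norm_rpow_of_tsupport_subset hq hsupp,
    setIntegral_norm_rpow_of_tsupport_subset (f := fderiv ℝ u) hp
      ((tsupport_fderiv_subset ℝ).trans hsupp), hθ']
  exact h u (hu.of_le (mod_cast le_top)) huc
end

section
/- Let q, β, α be real numbers with 1 < β < q − 1 and α > 0, set γ = 1/(β−1), and let C₁, C₂ > 0 satisfy (2γ)^γ ≤ C₁ ≤ (2α)^{1/(β−q+1)}·C₂^γ. Define w(t) = C₁(t + C₂)^{−γ} for t ≥ 0. Then for every t ≥ 0 one has w′(t) + w(t)^β − α·w(t)^{q−1} ≥ 0. -/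
/-- The spatially constant algebraic-decay supersolution w(t) = C₁(t+C₂)^{−γ}
satisfies w′ + w^β − α w^{q−1} ≥ 0 when 1 < β < q − 1, γ = 1/(β−1) and
(2γ)^γ ≤ C₁ ≤ (2α)^{1/(β−q+1)} C₂^γ. -/
theorem algebraic_decay_supersolution
    (q β α γ C₁ C₂ : ℝ) (hβ1 : 1 < β) (hβq : β < q - 1) (hα : 0 < α)
    (hγ : γ = 1 / (β - 1)) (hC₁ : 0 < C₁) (hC₂ : 0 < C₂)
    (hlow : (2 * γ) ^ γ ≤ C₁) (hhigh : C₁ ≤ (2 * α) ^ (1 / (β - q + 1)) * C₂ ^ γ)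
    (w : ℝ → ℝ) (hw : ∀ t : ℝ, w t = C₁ * (t + C₂) ^ (-γ)) :
    ∀ t : ℝ, 0 ≤ t → 0 ≤ deriv w t + w t ^ β - α * w t ^ (q - 1) := by
  intro t ht
  have hβ : 0 < β - 1 := by linarith
  have hγpos : 0 < γ := hγ ▸ one_div_pos.mpr hβ
  have hγβ : γ * (β - 1) = 1 := by rw [hγ]; field_simp
  have hs : 0 < t + C₂ := by linarith
  have hderiv : deriv w t = -(γ * C₁ * (t + C₂) ^ (-γ - 1)) := by
    have h := (((hasDerivAt_id t).add_const C₂).rpow_const (p := -γ) (.inl hs.ne')).const_mul C₁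
    rw [funext hw]
    refine h.deriv.trans ?_
    simp only [id]
    ring
  have hwpos : 0 < w t := by rw [hw]; positivity
  have hwβ : w t ^ β = C₁ ^ β * (t + C₂) ^ (-γ - 1) := by
    rw [hw, Real.mul_rpow hC₁.le (by positivity), ← Real.rpow_mul hs.le]
    congr 2
    linarith
  have hderiv_le : 2 * (γ * C₁ * (t + C₂) ^ (-γ - 1)) ≤ w t ^ β := by
    have hγC₁ : 2 * γ ≤ C₁ ^ (β - 1) := by
      have h := Real.rpow_le_rpow (by positivity) hlow hβ.le
      rwa [← Real.rpow_mul (by positivity), hγβ, Real.rpow_one] at h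
    have hC₁β : C₁ ^ β = C₁ ^ (β - 1) * C₁ := by
      rw [← Real.rpow_add_one hC₁.ne', sub_add_cancel]
    rw [hwβ, hC₁β, ← mul_assoc, ← mul_assoc]
    gcongr
  have hsource_le : 2 * (α * w t ^ (q - 1)) ≤ w t ^ β := by
    have hwle : w t ≤ (2 * α) ^ (1 / (β - q + 1)) := by
      have hdecay : (t + C₂) ^ (-γ) ≤ C₂ ^ (-γ) :=
        Real.rpow_le_rpow_of_nonpos hC₂ (by linarith) (by linarith)
      calc w t = C₁ * (t + C₂) ^ (-γ) := hw t
        _ ≤ ((2 * α) ^ (1 / (β - q + 1)) * C₂ ^ γ) * C₂ ^ (-γ) := by gcongr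
        _ = (2 * α) ^ (1 / (β - q + 1)) := by
          rw [mul_assoc, ← Real.rpow_add hC₂, add_neg_cancel, Real.rpow_zero, mul_one]
    have hpow : w t ^ (q - 1 - β) ≤ (2 * α)⁻¹ := by
      have h := Real.rpow_le_rpow hwpos.le hwle (show 0 ≤ q - 1 - β by linarith)
      have hexp : 1 / (β - q + 1) * (q - 1 - β) = -1 := by
        have : β - q + 1 ≠ 0 := by linarith
        field_simp
        ring
      rwa [← Real.rpow_mul (by positivity), hexp, Real.rpow_neg_one] at h
    calc 2 * (α * w t ^ (q - 1)) = 2 * α * w t ^ (q - 1 - β) * w t ^ β := by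
          rw [mul_assoc (2 * α), ← Real.rpow_add hwpos, sub_add_cancel, mul_assoc]
      _ ≤ 2 * α * (2 * α)⁻¹ * w t ^ β := by gcongr
      _ = w t ^ β := by rw [mul_inv_cancel₀ (by positivity), one_mul]
  rw [hderiv]
  linarith
end
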